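/- Let w : (0,∞) → [0,∞) be a Borel function with ∫_0^∞ w(x) dx = 1 satisfying the q-Pearson equation w(qx) = x·w(x) for all x > 0. Then the Stieltjes–Wigert polynomials are orthogonal in L²(w(x)dx): for all m, n ∈ ℕ, ∫_0^∞ S_n(x;q)·S_m(x;q)·w(x) dx = δ_{m,n}/(q^n·(q;q)_n). -/

import Mathlib

open MeasureTheory Finset

/-- The real q-Pochhammer symbol `(a;q)_n = ∏_{j=0}^{n-1} (1 - a q^j)`. -/
noncomputable def qPochR (q a : ℝ) (n : ℕ) : ℝ :=
  ∏ j ∈ Finset.range n, (1 - a * q ^ j)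

/-- The Stieltjes--Wigert polynomial
`S_n(x;q) = (1/(q;q)_n) Σ_{k=0}^n ((q;q)_n/((q;q)_k (q;q)_{n-k})) (-1)^k q^{k²} x^k`. -/
noncomputable def stieltjesWigertR (q : ℝ) (n : ℕ) (x : ℝ) : ℝ :=
  (1 / qPochR q q n) *
    ∑ k ∈ Finset.range (n + 1),
      (qPochR q q n / (qPochR q q k * qPochR q q (n - k))) * (-1) ^ k * q ^ (k ^ 2) * x ^ k

lemma qPochR_succ (q a : ℝ) (n : ℕ) :
    qPochR q a (n + 1) = qPochR q a n * (1 - a * q ^ n) :=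
  Finset.prod_range_succ _ _

lemma qPochR_self_pos {q : ℝ} (hq0 : 0 < q) (hq1 : q < 1) (n : ℕ) : 0 < qPochR q q n := by
  refine Finset.prod_pos fun j _ => ?_
  have h : q ^ (j + 1) < 1 := pow_lt_one₀ hq0.le hq1 (Nat.succ_ne_zero j)
  rw [pow_succ'] at h
  linarith

/-- The finite `q`-binomial theorem. -/
lemma sum_antidiagonal_qPochR {q : ℝ} (hq0 : 0 < q) (hq1 : q < 1) (z : ℝ) (n : ℕ) :
    qPochR q q n * ∑ p ∈ antidiagonal n,
      (-1) ^ p.1 * q ^ (p.1.choose 2) * z ^ p.1 / (qPochR q q p.1 * qPochR q q p.2) =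
    qPochR q z n := by
  induction n with
  | zero => simp [qPochR]
  | succ n ih =>
    have hP := fun k => (qPochR_self_pos hq0 hq1 k).ne'
    have hfac : ∀ k, 1 - q * q ^ k ≠ 0 := fun k h => hP (k + 1) (by rw [qPochR_succ, h, mul_zero])
    rw [qPochR_succ q z, ← ih, qPochR_succ, mul_assoc, mul_assoc]
    congr 1
    let t : ℕ × ℕ → ℝ := fun p =>
      (-1) ^ p.1 * q ^ (p.1.choose 2) * z ^ p.1 / (qPochR q q p.1 * qPochR q q p.2)
    have hsplit : (1 - q * q ^ n) * ∑ p ∈ antidiagonal (n + 1), t p =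
        ∑ p ∈ antidiagonal (n + 1), (1 - q ^ p.2) * t p +
        ∑ p ∈ antidiagonal (n + 1), q ^ p.2 * (1 - q ^ p.1) * t p := by
      rw [Finset.mul_sum, ← Finset.sum_add_distrib]
      refine Finset.sum_congr rfl fun p hp => ?_
      rw [← pow_succ', ← mem_antidiagonal.1 hp, pow_add]
      ring
    have hleft : ∑ p ∈ antidiagonal (n + 1), (1 - q ^ p.2) * t p =
        ∑ p ∈ antidiagonal n, t p := by
      rw [Finset.Nat.sum_antidiagonal_succ']
      simp only [pow_zero, sub_self, zero_mul, zero_add]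
      refine Finset.sum_congr rfl fun p _ => ?_
      have := hP p.1
      have := hP p.2
      have := hfac p.2
      simp only [t, qPochR_succ, pow_succ' q p.2]
      field_simp
    have hright : ∑ p ∈ antidiagonal (n + 1), q ^ p.2 * (1 - q ^ p.1) * t p =
        -(z * q ^ n) * ∑ p ∈ antidiagonal n, t p := by
      rw [Finset.Nat.sum_antidiagonal_succ, Finset.mul_sum]
      simp only [pow_zero, sub_self, zero_mul, zero_add, mul_zero]
      refine Finset.sum_congr rfl fun p hp => ?_
      have := hP p.1
      have := hP p.2
      have := hfac p.1
      have hc : (p.1 + 1).choose 2 = p.1 + p.1.choose 2 := by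
        simp [Nat.choose_succ_succ' p.1 1]
      simp only [t, qPochR_succ, hc, ← mem_antidiagonal.1 hp, pow_succ' q p.1, pow_add]
      field_simp
    change (1 - q * q ^ n) * ∑ p ∈ antidiagonal (n + 1), t p =
      (∑ p ∈ antidiagonal n, t p) * (1 - z * q ^ n)
    rw [hsplit, hleft, hright]
    ring

lemma stieltjesWigertR_eq_sum {q : ℝ} (hq0 : 0 < q) (hq1 : q < 1) (n : ℕ) (x : ℝ) :
    stieltjesWigertR q n x = ∑ k ∈ range (n + 1),
      (-1) ^ k * q ^ (k ^ 2) / (qPochR q q k * qPochR q q (n - k)) * x ^ k := by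
  rw [stieltjesWigertR, Finset.mul_sum]
  refine Finset.sum_congr rfl fun k _ => ?_
  have := (qPochR_self_pos hq0 hq1 n).ne'
  field_simp

/-- Solutions of the `q`-Pearson equation have the log-normal moments `q ^ (-k (k + 1) / 2)`. -/
lemma moment_of_qPearson {q : ℝ} (hq0 : 0 < q) {w : ℝ → ℝ}
    (hw_prob : ∫ x in Set.Ioi (0 : ℝ), w x = 1)
    (hPearson : ∀ x ∈ Set.Ioi (0 : ℝ), w (q * x) = x * w x) (k : ℕ) :
    IntegrableOn (fun x => x ^ k * w x) (Set.Ioi 0) ∧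
      ∫ x in Set.Ioi (0 : ℝ), x ^ k * w x = (q ^ (k + 1).choose 2)⁻¹ := by
  induction k with
  | zero =>
    refine ⟨?_, by simpa using hw_prob⟩
    simp only [pow_zero, one_mul]
    by_contra h
    rw [integral_undef h] at hw_prob
    exact zero_ne_one hw_prob
  | succ k ih =>
    obtain ⟨hint, hval⟩ := ih
    have heq : ∀ x ∈ Set.Ioi (0 : ℝ),
        (q * x) ^ k * w (q * x) = q ^ k * (x ^ (k + 1) * w x) := fun x hx => by
      rw [hPearson x hx]
      ring
    have hqk : q ^ k ≠ 0 := (pow_pos hq0 k).ne'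
    constructor
    · have h := (integrableOn_Ioi_comp_mul_left_iff (fun x => x ^ k * w x) 0 hq0).2
        (by simpa using hint)
      have h' : IntegrableOn (fun x => q ^ k * (x ^ (k + 1) * w x)) (Set.Ioi 0) :=
        h.congr_fun heq measurableSet_Ioi
      refine (h'.const_mul (q ^ k)⁻¹).congr (ae_of_all _ fun x => ?_)
      exact inv_mul_cancel_left₀ hqk _
    · have h := integral_comp_mul_left_Ioi (fun x => x ^ k * w x) 0 hq0
      rw [setIntegral_congr_fun measurableSet_Ioi heq, integral_const_mul, mul_zero, hval,
        smul_eq_mul] at h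
      have hc : (k + 1 + 1).choose 2 = k + 1 + (k + 1).choose 2 := by
        simp [Nat.choose_succ_succ' (k + 1) 1]
      rw [hc, pow_add, pow_succ, ← mul_right_inj' hqk, h]
      field_simp

lemma sq_add_choose_two (j k : ℕ) :
    k ^ 2 + (j + 1).choose 2 + j * k = k.choose 2 + (k + j + 1).choose 2 := by
  induction k with
  | zero => simp
  | succ k ih =>
    have h1 : (k + 1).choose 2 = k + k.choose 2 := by simp [Nat.choose_succ_succ' k 1]
    have h2 : (k + 1 + j + 1).choose 2 = (k + j + 1) + (k + j + 1).choose 2 := by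
      rw [show k + 1 + j + 1 = (k + j + 1) + 1 by ring]
      simp [Nat.choose_succ_succ' (k + j + 1) 1]
    rw [h1, h2]
    linarith

lemma integral_stieltjesWigertR_mul_pow {q : ℝ} (hq0 : 0 < q) (hq1 : q < 1) {w : ℝ → ℝ}
    (hw_prob : ∫ x in Set.Ioi (0 : ℝ), w x = 1)
    (hPearson : ∀ x ∈ Set.Ioi (0 : ℝ), w (q * x) = x * w x) (n j : ℕ) :
    IntegrableOn (fun x => stieltjesWigertR q n x * (x ^ j * w x)) (Set.Ioi 0) ∧
      ∫ x in Set.Ioi (0 : ℝ), stieltjesWigertR q n x * (x ^ j * w x) =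
        (q ^ (j + 1).choose 2)⁻¹ * qPochR q (q ^ j)⁻¹ n / qPochR q q n := by
  have hmom := moment_of_qPearson hq0 hw_prob hPearson
  have hexp : (fun x => stieltjesWigertR q n x * (x ^ j * w x)) = fun x =>
      ∑ k ∈ range (n + 1), (-1) ^ k * q ^ (k ^ 2) / (qPochR q q k * qPochR q q (n - k)) *
        (x ^ (k + j) * w x) := by
    ext x
    rw [stieltjesWigertR_eq_sum hq0 hq1, Finset.sum_mul]
    refine Finset.sum_congr rfl fun k _ => ?_
    ring
  rw [hexp]
  refine ⟨integrable_finsetSum _ fun k _ => (hmom (k + j)).1.const_mul _, ?_⟩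
  rw [integral_finsetSum _ fun k _ => (hmom (k + j)).1.const_mul _,
    ← sum_antidiagonal_qPochR hq0 hq1, Finset.Nat.sum_antidiagonal_eq_sum_range_succ_mk,
    mul_div_assoc, mul_div_cancel_left₀ _ (qPochR_self_pos hq0 hq1 n).ne', Finset.mul_sum]
  refine Finset.sum_congr rfl fun k _ => ?_
  rw [integral_const_mul, (hmom (k + j)).2]
  have h := congrArg (q ^ ·) (sq_add_choose_two j k)
  simp only [pow_add q, pow_mul] at h
  have h1 := (qPochR_self_pos hq0 hq1 k).ne'
  have h2 := (qPochR_self_pos hq0 hq1 (n - k)).ne'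
  have hq := hq0.ne'
  rw [inv_pow]
  field_simp
  linear_combination h

lemma qPochR_inv_pow_of_lt {q : ℝ} (hq : q ≠ 0) {j n : ℕ} (h : j < n) :
    qPochR q (q ^ j)⁻¹ n = 0 :=
  Finset.prod_eq_zero (mem_range.2 h) (by rw [inv_mul_cancel₀ (pow_ne_zero j hq), sub_self])

lemma qPochR_inv_pow_self {q : ℝ} (hq : q ≠ 0) (n : ℕ) :
    qPochR q (q ^ n)⁻¹ n = (-1) ^ n * (q ^ (n + 1).choose 2)⁻¹ * qPochR q q n := by
  have hsum : (n + 1).choose 2 = ∑ i ∈ range n, (i + 1) := by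
    induction n with
    | zero => simp
    | succ n ih =>
      rw [Finset.sum_range_succ, ← ih, Nat.choose_succ_succ' (n + 1) 1, Nat.choose_one_right,
        add_comm]
  have hsign : (-1 : ℝ) ^ n = ∏ _i ∈ range n, (-1) := by simp
  rw [qPochR, ← Finset.prod_range_reflect, hsum, ← Finset.prod_pow_eq_pow_sum,
    ← Finset.prod_inv_distrib, qPochR, hsign, ← Finset.prod_mul_distrib,
    ← Finset.prod_mul_distrib]
  refine Finset.prod_congr rfl fun i hi => ?_
  obtain ⟨d, rfl⟩ := Nat.exists_eq_add_of_lt (mem_range.1 hi)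
  rw [show i + d + 1 - 1 - i = d by omega, show i + d + 1 = d + (i + 1) by ring, pow_add q d]
  field_simp
  ring

lemma integral_stieltjesWigertR_mul_of_le {q : ℝ} (hq0 : 0 < q) (hq1 : q < 1) {w : ℝ → ℝ}
    (hw_prob : ∫ x in Set.Ioi (0 : ℝ), w x = 1)
    (hPearson : ∀ x ∈ Set.Ioi (0 : ℝ), w (q * x) = x * w x) {n m : ℕ} (hmn : m ≤ n) :
    ∫ x in Set.Ioi (0 : ℝ), stieltjesWigertR q n x * stieltjesWigertR q m x * w x =
      (if m = n then 1 else 0) / (q ^ n * qPochR q q n) := by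
  have hS := integral_stieltjesWigertR_mul_pow hq0 hq1 hw_prob hPearson n
  have hexp : (fun x => stieltjesWigertR q n x * stieltjesWigertR q m x * w x) = fun x =>
      ∑ k ∈ range (m + 1), (-1) ^ k * q ^ (k ^ 2) / (qPochR q q k * qPochR q q (m - k)) *
        (stieltjesWigertR q n x * (x ^ k * w x)) := by
    ext x
    rw [stieltjesWigertR_eq_sum hq0 hq1 m, Finset.mul_sum, Finset.sum_mul]
    refine Finset.sum_congr rfl fun k _ => ?_
    ring
  rw [hexp, integral_finsetSum _ fun k _ => (hS k).1.const_mul _, Finset.sum_range_succ,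
    Finset.sum_eq_zero, zero_add, integral_const_mul, (hS m).2]
  · rcases hmn.eq_or_lt with rfl | hlt
    · have hP := (qPochR_self_pos hq0 hq1 m).ne'
      have hq := hq0.ne'
      have hsq : q ^ (m ^ 2) * q ^ m = q ^ (m + 1).choose 2 * q ^ (m + 1).choose 2 := by
        have h := sq_add_choose_two 0 m
        have hc : (m + 1).choose 2 = m + m.choose 2 := by simp [Nat.choose_succ_succ' m 1]
        rw [← pow_add, ← pow_add]
        congr 1
        simp at h
        omega
      have hone : ((-1 : ℝ) ^ m) * (-1) ^ m = 1 := by rw [← mul_pow]; simp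
      have hP0 : qPochR q q 0 = 1 := by simp [qPochR]
      rw [qPochR_inv_pow_self hq, if_pos rfl, Nat.sub_self, hP0]
      field_simp
      linear_combination (q ^ (m ^ 2) * q ^ m) * hone + hsq
    · rw [qPochR_inv_pow_of_lt hq0.ne' hlt, if_neg hlt.ne]
      simp
  · intro k hk
    rw [integral_const_mul, (hS k).2,
      qPochR_inv_pow_of_lt hq0.ne' ((mem_range.1 hk).trans_le hmn)]
    simp

/-- let `w : (0,∞) → [0,∞)` be a Borel probability density satisfying the
q-Pearson equation `w(qx) = x w(x)` for all `x > 0`. Then the Stieltjes--Wigert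
polynomials are orthogonal in `L²(w(x)dx)`:
`∫_0^∞ S_n(x;q) S_m(x;q) w(x) dx = δ_{m,n}/(q^n (q;q)_n)`. -/
theorem stieltjesWigert_ac_orthogonality (q : ℝ) (hq0 : 0 < q) (hq1 : q < 1)
    (w : ℝ → ℝ) (hw_meas : Measurable w) (hw_nonneg : ∀ x ∈ Set.Ioi (0 : ℝ), 0 ≤ w x)
    (hw_prob : ∫ x in Set.Ioi (0 : ℝ), w x = 1)
    (hPearson : ∀ x ∈ Set.Ioi (0 : ℝ), w (q * x) = x * w x) (n m : ℕ) :
    ∫ x in Set.Ioi (0 : ℝ), stieltjesWigertR q n x * stieltjesWigertR q m x * w x =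
      (if m = n then 1 else 0) / (q ^ n * qPochR q q n) := by
  rcases le_total m n with h | h
  · exact integral_stieltjesWigertR_mul_of_le hq0 hq1 hw_prob hPearson h
  · have key := integral_stieltjesWigertR_mul_of_le hq0 hq1 hw_prob hPearson h
    simp only [mul_comm (stieltjesWigertR q m _)] at key
    rw [key]
    by_cases hmn : m = n
    · rw [hmn]
    · rw [if_neg hmn, if_neg (Ne.symm hmn), zero_div, zero_div]
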